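/- Let M > 0, let r : ℝ² → ℝ be a Schwarzschild double-null radius function, and let Ψ : ℝ² → ℝ be a smooth solution of the spherically symmetric wave equation. Define the coercive T-energy fluxes E_u(v₀,v₁) := ∫_{v₀}^{v₁} r²·(∂_vΨ)²(u,v) dv and E̲_v(u₀,u₁) := ∫_{u₀}^{u₁} r²·(∂_uΨ)²(u,v) du. Then for all u₀ ≤ u₁ and v₀ ≤ v₁ one has the energy boundedness estimate E_{u₁}(v₀,v₁) + E̲_{v₁}(u₀,u₁) ≤ E_{u₀}(v₀,v₁) + E̲_{v₀}(u₀,u₁); in particular E_{u₁}(v₀,v₁) ≤ E_{u₀}(v₀,v₁) + E̲_{v₀}(u₀,u₁). (This is the coercive energy boundedness statement E^T_{u₁} + E^T_{v₁} ≤ E^T_data following from the conservation law and nonnegativity of the energy fluxes, restricted to spherically symmetric solutions on a characteristic rectangle.) -/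

import Mathlib

open MeasureTheory Filter Set

/-- Partial derivative in the first (u) variable. -/
noncomputable def pdu (f : ℝ → ℝ → ℝ) (u v : ℝ) : ℝ := deriv (fun x => f x v) u

/-- Partial derivative in the second (v) variable. -/
noncomputable def pdv (f : ℝ → ℝ → ℝ) (u v : ℝ) : ℝ := deriv (fun y => f u y) v

/-- Schwarzschild double-null radius function: smooth, `r > 2M`,
`∂r/∂v = 1 − 2M/r`, `∂r/∂u = −(1 − 2M/r)`. -/
def IsSchwRadius (M : ℝ) (r : ℝ → ℝ → ℝ) : Prop :=
  ContDiff ℝ (⊤ : ℕ∞) (Function.uncurry r) ∧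
  (∀ u v, 2 * M < r u v) ∧
  (∀ u v, pdv r u v = 1 - 2 * M / r u v) ∧
  (∀ u v, pdu r u v = -(1 - 2 * M / r u v))

/-- A smooth solution of the spherically symmetric wave equation
`∂²Ψ/∂u∂v = (Ω²/r)(∂Ψ/∂v − ∂Ψ/∂u)` on the Schwarzschild exterior,
where `Ω² = 1 − 2M/r`. -/
def IsWaveSolution (M : ℝ) (r Ψ : ℝ → ℝ → ℝ) : Prop :=
  ContDiff ℝ (⊤ : ℕ∞) (Function.uncurry Ψ) ∧
  ∀ u v, pdu (fun a b => pdv Ψ a b) u v =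
    ((1 - 2 * M / r u v) / r u v) * (pdv Ψ u v - pdu Ψ u v)

/-- The `u`-derivative is the total derivative applied to the first basis vector. -/
theorem pdu_eq_fderiv {f : ℝ → ℝ → ℝ} (hf : Differentiable ℝ (Function.uncurry f)) (u v : ℝ) :
    pdu f u v = fderiv ℝ (Function.uncurry f) (u, v) (1, 0) :=
  ((hf (u, v)).hasFDerivAt.comp_hasDerivAt (f := fun x => (x, v)) u
    ((hasDerivAt_id u).prodMk (hasDerivAt_const u v))).deriv

/-- The `v`-derivative is the total derivative applied to the second basis vector. -/
theorem pdv_eq_fderiv {f : ℝ → ℝ → ℝ} (hf : Differentiable ℝ (Function.uncurry f)) (u v : ℝ) :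
    pdv f u v = fderiv ℝ (Function.uncurry f) (u, v) (0, 1) :=
  ((hf (u, v)).hasFDerivAt.comp_hasDerivAt (f := fun y => (u, y)) v
    ((hasDerivAt_const v u).prodMk (hasDerivAt_id v))).deriv

theorem uncurry_pdu_eq {f : ℝ → ℝ → ℝ} (hf : Differentiable ℝ (Function.uncurry f)) :
    Function.uncurry (pdu f) = fun p => fderiv ℝ (Function.uncurry f) p (1, 0) :=
  funext fun p => pdu_eq_fderiv hf p.1 p.2

theorem uncurry_pdv_eq {f : ℝ → ℝ → ℝ} (hf : Differentiable ℝ (Function.uncurry f)) :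
    Function.uncurry (pdv f) = fun p => fderiv ℝ (Function.uncurry f) p (0, 1) :=
  funext fun p => pdv_eq_fderiv hf p.1 p.2

theorem contDiff_pdu {f : ℝ → ℝ → ℝ} (hf : ContDiff ℝ 2 (Function.uncurry f)) :
    ContDiff ℝ 1 (Function.uncurry (pdu f)) := by
  rw [uncurry_pdu_eq (hf.differentiable (by norm_num))]
  exact (hf.fderiv_right (by norm_num)).clm_apply contDiff_const

theorem contDiff_pdv {f : ℝ → ℝ → ℝ} (hf : ContDiff ℝ 2 (Function.uncurry f)) :
    ContDiff ℝ 1 (Function.uncurry (pdv f)) := by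
  rw [uncurry_pdv_eq (hf.differentiable (by norm_num))]
  exact (hf.fderiv_right (by norm_num)).clm_apply contDiff_const

theorem hasDerivAt_pdu {f : ℝ → ℝ → ℝ} (hf : Differentiable ℝ (Function.uncurry f)) (u v : ℝ) :
    HasDerivAt (fun x => f x v) (pdu f u v) u :=
  DifferentiableAt.hasDerivAt <|
    (hf (u, v)).comp (f := fun x => (x, v)) u (by fun_prop)

theorem hasDerivAt_pdv {f : ℝ → ℝ → ℝ} (hf : Differentiable ℝ (Function.uncurry f)) (u v : ℝ) :
    HasDerivAt (fun y => f u y) (pdv f u v) v :=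
  DifferentiableAt.hasDerivAt <|
    (hf (u, v)).comp (f := fun y => (u, y)) v (by fun_prop)

/-- Mixed partial derivatives of a `C²` function commute. -/
theorem pdv_pdu_comm {f : ℝ → ℝ → ℝ} (hf : ContDiff ℝ 2 (Function.uncurry f)) (u v : ℝ) :
    pdv (pdu f) u v = pdu (pdv f) u v := by
  have hd : Differentiable ℝ (Function.uncurry f) := hf.differentiable (by norm_num)
  have hd' : DifferentiableAt ℝ (fderiv ℝ (Function.uncurry f)) (u, v) :=
    (hf.fderiv_right (m := 1) (by norm_num)).differentiable (by norm_num) _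
  rw [pdv_eq_fderiv ((contDiff_pdu hf).differentiable (by norm_num)),
    pdu_eq_fderiv ((contDiff_pdv hf).differentiable (by norm_num)),
    uncurry_pdu_eq hd, uncurry_pdv_eq hd, fderiv_clm_apply hd' (by fun_prop),
    fderiv_clm_apply hd' (by fun_prop)]
  simpa using (hf.contDiffAt.isSymmSndFDerivAt (by simp)).eq (0, 1) (1, 0)

/-- The fluxes of a divergence-free `C¹` field through opposite sides of a rectangle balance. -/
theorem integral_flux_eq_of_divergence_eq_zero {A B : ℝ → ℝ → ℝ}
    (hA : ContDiff ℝ 1 (Function.uncurry A)) (hB : ContDiff ℝ 1 (Function.uncurry B))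
    (h : ∀ u v, pdu A u v + pdv B u v = 0) (u₀ u₁ v₀ v₁ : ℝ) :
    (∫ v in v₀..v₁, A u₁ v) + (∫ u in u₀..u₁, B u v₁) =
      (∫ v in v₀..v₁, A u₀ v) + (∫ u in u₀..u₁, B u v₀) := by
  have hdA : Differentiable ℝ (Function.uncurry A) := hA.differentiable (by norm_num)
  have hdB : Differentiable ℝ (Function.uncurry B) := hB.differentiable (by norm_num)
  have hdiv : ∀ p : ℝ × ℝ, fderiv ℝ (Function.uncurry A) p (1, 0) +
      fderiv ℝ (Function.uncurry B) p (0, 1) = 0 := fun p => by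
    rw [← pdu_eq_fderiv hdA p.1 p.2, ← pdv_eq_fderiv hdB p.1 p.2, h]
  have key := integral2_divergence_prod_of_hasFDerivAt
    (Function.uncurry A) (Function.uncurry B) (fderiv ℝ (Function.uncurry A))
    (fderiv ℝ (Function.uncurry B)) u₀ v₀ u₁ v₁
    hA.continuous.continuousOn hB.continuous.continuousOn
    (fun p _ => (hdA p).hasFDerivAt) (fun p _ => (hdB p).hasFDerivAt)
    (by simp only [hdiv]; exact integrableOn_zero)
  simp only [hdiv, intervalIntegral.integral_zero, Function.uncurry_apply_pair] at key
  linarith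

/-- The energy density fluxes `r²(∂_vΨ)²` and `r²(∂_uΨ)²` form a divergence-free field. -/
theorem energy_current_divergence_eq_zero {M : ℝ} (hM : 0 < M) {r Ψ : ℝ → ℝ → ℝ}
    (hr : IsSchwRadius M r) (hΨ : IsWaveSolution M r Ψ) (u v : ℝ) :
    pdu (fun u v => (r u v) ^ 2 * (pdv Ψ u v) ^ 2) u v +
      pdv (fun u v => (r u v) ^ 2 * (pdu Ψ u v) ^ 2) u v = 0 := by
  obtain ⟨hrs, hr2, hrv, hru⟩ := hr
  obtain ⟨hΨs, hw⟩ := hΨ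
  have hΨ2 : ContDiff ℝ 2 (Function.uncurry Ψ) := contDiff_infty.1 hΨs 2
  have hrd : Differentiable ℝ (Function.uncurry r) := hrs.differentiable (by simp)
  have hA := ((hasDerivAt_pdu hrd u v).pow 2).mul
    ((hasDerivAt_pdu ((contDiff_pdv hΨ2).differentiable (by norm_num)) u v).pow 2)
  have hB := ((hasDerivAt_pdv hrd u v).pow 2).mul
    ((hasDerivAt_pdv ((contDiff_pdu hΨ2).differentiable (by norm_num)) u v).pow 2)
  have hr0 : r u v ≠ 0 := (show 0 < r u v by linarith [hr2 u v]).ne'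
  have hw' : pdu (pdv Ψ) u v = _ := hw u v
  rw [pdv_pdu_comm hΨ2, hw', hrv] at hB
  rw [hw', hru] at hA
  refine (congrArg₂ (· + ·) hA.deriv hB.deriv).trans ?_
  simp only [Pi.pow_apply]
  field_simp
  ring

/-- Coercive `T`-energy boundedness on a characteristic rectangle, for spherically
symmetric solutions: `E_{u₁} + E̲_{v₁} ≤ E_{u₀} + E̲_{v₀}`, and in particular
`E_{u₁} ≤ E_{u₀} + E̲_{v₀}`. -/
theorem T_energy_boundedness
    (M : ℝ) (hM : 0 < M) (r Ψ : ℝ → ℝ → ℝ)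
    (hr : IsSchwRadius M r) (hΨ : IsWaveSolution M r Ψ) :
    ∀ u₀ u₁ v₀ v₁ : ℝ, u₀ ≤ u₁ → v₀ ≤ v₁ →
      ((∫ v in v₀..v₁, (r u₁ v) ^ 2 * (pdv Ψ u₁ v) ^ 2) +
          (∫ u in u₀..u₁, (r u v₁) ^ 2 * (pdu Ψ u v₁) ^ 2) ≤
        (∫ v in v₀..v₁, (r u₀ v) ^ 2 * (pdv Ψ u₀ v) ^ 2) +
          (∫ u in u₀..u₁, (r u v₀) ^ 2 * (pdu Ψ u v₀) ^ 2)) ∧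
      ((∫ v in v₀..v₁, (r u₁ v) ^ 2 * (pdv Ψ u₁ v) ^ 2) ≤
        (∫ v in v₀..v₁, (r u₀ v) ^ 2 * (pdv Ψ u₀ v) ^ 2) +
          (∫ u in u₀..u₁, (r u v₀) ^ 2 * (pdu Ψ u v₀) ^ 2)) := by
  intro u₀ u₁ v₀ v₁ hu _
  have hr1 : ContDiff ℝ 1 (Function.uncurry r) := hr.1.of_le (by exact_mod_cast le_top)
  have hΨ2 : ContDiff ℝ 2 (Function.uncurry Ψ) := contDiff_infty.1 hΨ.1 2
  have hcons := integral_flux_eq_of_divergence_eq_zero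
    (A := fun u v => (r u v) ^ 2 * (pdv Ψ u v) ^ 2)
    (B := fun u v => (r u v) ^ 2 * (pdu Ψ u v) ^ 2)
    ((hr1.pow 2).mul ((contDiff_pdv hΨ2).pow 2)) ((hr1.pow 2).mul ((contDiff_pdu hΨ2).pow 2))
    (energy_current_divergence_eq_zero hM hr hΨ) u₀ u₁ v₀ v₁
  have hnonneg : 0 ≤ ∫ u in u₀..u₁, (r u v₁) ^ 2 * (pdu Ψ u v₁) ^ 2 :=
    intervalIntegral.integral_nonneg hu fun u _ => by positivity
  exact ⟨hcons.le, by linarith⟩
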